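/- Let (β_i)_{i≥1} be strictly positive reals and let μ^{(n)} be the Feynman–Thomas measure on ℝⁿ, the complex measure with density ρ_n(x) = ∫_{(0,∞)ⁿ} [ Π_{i=1}^{n} (1/β_i) e^{−s_i/β_i} ] g_{s,n}(x) ds₁…dsₙ, where g_{s,n}(x) = (2π)^{−n} ∫_{ℝⁿ} exp( −⟨(diag(s) + i K^{(n)})ξ, ξ⟩/2 − i⟨ξ, x⟩ ) dξ and K^{(n)}_{jk} = min(j,k). Then for every ξ ∈ ℝⁿ, ∫_{ℝⁿ} e^{i⟨ξ,x⟩} μ^{(n)}(dx) = [ Π_{i=1}^{n} (1 + β_i ξ_i²/2)^{−1} ] · exp( −(i/2) Σ_{j,k=1}^{n} min(j,k) ξ_j ξ_k ). -/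

import Mathlib

open MeasureTheory Matrix Set

/-- The discrete-time Brownian covariance matrix `K^{(n)}_{jk} = min(j,k)` (indices
`j,k : Fin n` standing for the indices `j+1, k+1 ∈ {1,…,n}` of the paper). -/
def Kmin (n : ℕ) : Matrix (Fin n) (Fin n) ℝ :=
  Matrix.of fun j k => ((min ((j : ℕ) + 1) ((k : ℕ) + 1) : ℕ) : ℝ)

/-- `A^{(n)}(s) = diag(s₁,…,sₙ) + i·K^{(n)}`. -/
noncomputable def Amat (n : ℕ) (s : Fin n → ℝ) : Matrix (Fin n) (Fin n) ℂ :=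
  (Matrix.diagonal s).map Complex.ofReal + Complex.I • (Kmin n).map Complex.ofReal

/-- `g_{s,n}(x) = (2π)^{−n} ∫_{ℝⁿ} exp(−⟨A^{(n)}(s)ξ,ξ⟩/2 − i⟨ξ,x⟩) dξ`. -/
noncomputable def gsn (n : ℕ) (s : Fin n → ℝ) (x : Fin n → ℝ) : ℂ :=
  (((2 * Real.pi) ^ n : ℝ)⁻¹ : ℝ) •
    ∫ ξ : Fin n → ℝ,
      Complex.exp (-(∑ j : Fin n, ∑ k : Fin n, Amat n s j k * (ξ j : ℂ) * (ξ k : ℂ)) / 2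
        - Complex.I * (∑ j : Fin n, (ξ j : ℂ) * (x j : ℂ)))

/-- The density `ρ_n(x) = ∫_{(0,∞)ⁿ} Π_i (1/β_i)e^{−s_i/β_i} · g_{s,n}(x) ds` of the
Feynman–Thomas measure `μ^{(n)}` on `ℝⁿ`. -/
noncomputable def rhoFT (β : ℕ → ℝ) (n : ℕ) (x : Fin n → ℝ) : ℂ :=
  ∫ s in Set.univ.pi (fun _ : Fin n => Ioi (0 : ℝ)),
    ((∏ i : Fin n, (β (i : ℕ))⁻¹ * Real.exp (-(s i) / β (i : ℕ)) : ℝ) : ℂ) * gsn n s x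

theorem integral_gaussian_character {c : ℂ} (hc : 0 < c.re) (y : ℝ) :
    ∫ η : ℝ, Complex.exp (-(c * (η : ℂ) ^ 2) / 2 - Complex.I * (η * y)) =
      (2 * Real.pi / c) ^ (1 / 2 : ℂ) * Complex.exp (-((y : ℂ) ^ 2) / (2 * c)) := by
  have h := fourierIntegral_gaussian (b := c / 2) (by simpa using hc) (-y)
  convert h using 2
  · ext η
    rw [← Complex.exp_add]
    congr 1
    ring
  · congr 1
    field_simp
  · congr 1
    rw [neg_sq]
    congr 1
    ring

theorem integral_character_mul_gaussian_transform {c : ℂ} (hc : 0 < c.re) (ζ : ℝ) :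
    ∫ y : ℝ, Complex.exp (Complex.I * (ζ * y)) *
        ((2 * Real.pi / c) ^ (1 / 2 : ℂ) * Complex.exp (-((y : ℂ) ^ 2) / (2 * c))) =
      2 * Real.pi * Complex.exp (-(c * (ζ : ℂ) ^ 2) / 2) := by
  have hc0 : c ≠ 0 := fun h => by simp [h] at hc
  have hinv : 0 < (c⁻¹).re := by
    rw [Complex.inv_re]
    exact div_pos hc (Complex.normSq_pos.2 hc0)
  have h := fourierIntegral_gaussian (b := c⁻¹ / 2) (by simpa using hinv) ζ
  have harg : c.arg ≠ Real.pi := fun h => by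
    have := (Complex.arg_eq_pi_iff.1 h).1
    linarith
  have hpi : (0 : ℝ) < 2 * Real.pi := by positivity
  have hpi0 : (2 * Real.pi : ℂ) ≠ 0 := by exact_mod_cast hpi.ne'
  have hsqrt : (2 * Real.pi / c : ℂ) ^ (1 / 2 : ℂ) * (2 * Real.pi * c) ^ (1 / 2 : ℂ) =
      2 * Real.pi := by
    rw [Complex.cpow_def_of_ne_zero (div_ne_zero hpi0 hc0),
      Complex.cpow_def_of_ne_zero (mul_ne_zero hpi0 hc0), ← Complex.exp_add, div_eq_mul_inv]
    have h1 := Complex.log_ofReal_mul hpi (inv_ne_zero hc0)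
    have h2 := Complex.log_ofReal_mul hpi hc0
    push_cast at h1 h2
    rw [h1, h2, Complex.log_inv _ harg]
    rw [show ((Real.log (2 * Real.pi) + -Complex.log c) * (1 / 2) +
      (Real.log (2 * Real.pi) + Complex.log c) * (1 / 2) : ℂ) = Real.log (2 * Real.pi) by ring,
      ← Complex.ofReal_exp, Real.exp_log hpi]
    push_cast
    rfl
  calc _ = (2 * Real.pi / c : ℂ) ^ (1 / 2 : ℂ) *
        ∫ y : ℝ, Complex.exp (Complex.I * ζ * y) * Complex.exp (-(c⁻¹ / 2) * (y : ℂ) ^ 2) := by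
        rw [← integral_const_mul]
        congr 1 with y
        rw [show -((y : ℂ) ^ 2) / (2 * c) = -(c⁻¹ / 2) * (y : ℂ) ^ 2 by field_simp, ← mul_assoc Complex.I]
        ring
    _ = _ := by
        rw [h, ← mul_assoc, show (Real.pi / (c⁻¹ / 2) : ℂ) = 2 * Real.pi * c by field_simp, hsqrt]
        congr 2
        field_simp
        ring

theorem norm_gaussian_transform {c : ℂ} (hc : c.re = 1) (y : ℝ) :
    ‖(2 * Real.pi / c) ^ (1 / 2 : ℂ) * Complex.exp (-((y : ℂ) ^ 2) / (2 * c))‖ =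
      √(2 * Real.pi / ‖c‖) * Real.exp (-(1 / (2 * ‖c‖ ^ 2)) * y ^ 2) := by
  have hc0 : c ≠ 0 := fun h => by simp [h] at hc
  rw [norm_mul, Complex.norm_exp]
  congr 1
  · have := Complex.norm_cpow_real (2 * Real.pi / c) (1 / 2)
    push_cast at this
    rw [this, Real.sqrt_eq_rpow, norm_div]
    simp [abs_of_pos Real.pi_pos]
  · congr 1
    have hc1 : (c⁻¹).re = 1 / ‖c‖ ^ 2 := by rw [Complex.inv_re, hc, Complex.normSq_eq_norm_sq]
    rw [show -((y : ℂ) ^ 2) / (2 * c) = ((-(y ^ 2) / 2 : ℝ) : ℂ) * c⁻¹ by push_cast; field_simp,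
      Complex.re_ofReal_mul, hc1]
    field_simp

theorem integrable_gaussian_transform {c : ℂ} (hc : c.re = 1) :
    Integrable fun y : ℝ =>
      (2 * Real.pi / c) ^ (1 / 2 : ℂ) * Complex.exp (-((y : ℂ) ^ 2) / (2 * c)) := by
  have hc0 : c ≠ 0 := fun h => by simp [h] at hc
  rw [← integrable_norm_iff (by fun_prop)]
  simp_rw [norm_gaussian_transform hc]
  exact (integrable_exp_neg_mul_sq (by positivity)).const_mul _

theorem integral_norm_gaussian_transform {c : ℂ} (hc : c.re = 1) :
    ∫ y : ℝ, ‖(2 * Real.pi / c) ^ (1 / 2 : ℂ) * Complex.exp (-((y : ℂ) ^ 2) / (2 * c))‖ =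
      2 * Real.pi * √‖c‖ := by
  have hc0 : c ≠ 0 := fun h => by simp [h] at hc
  have hn : 0 < ‖c‖ := norm_pos_iff.2 hc0
  simp_rw [norm_gaussian_transform hc]
  rw [integral_const_mul, integral_gaussian, ← Real.sqrt_mul (by positivity),
    show 2 * Real.pi / ‖c‖ * (Real.pi / (1 / (2 * ‖c‖ ^ 2))) = (2 * Real.pi) ^ 2 * ‖c‖ by
      field_simp, Real.sqrt_mul (by positivity), Real.sqrt_sq (by positivity)]

theorem measurableEmbedding_toLin' {n : ℕ} {P : Matrix (Fin n) (Fin n) ℝ} (hP : P.det ≠ 0) :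
    MeasurableEmbedding (toLin' P) :=
  (LinearMap.equivOfDetNeZero (toLin' P)
    (by rwa [LinearMap.det_toLin'])).toContinuousLinearEquiv.toHomeomorph.measurableEmbedding

theorem integral_comp_mulVec {n : ℕ} {P : Matrix (Fin n) (Fin n) ℝ} (hP : P.det ≠ 0)
    {E : Type*} [NormedAddCommGroup E] [NormedSpace ℝ E] (f : (Fin n → ℝ) → E) :
    ∫ v, f (P *ᵥ v) = |P.det|⁻¹ • ∫ v, f v := by
  have hemb := measurableEmbedding_toLin' hP
  have h := hemb.integral_map (μ := volume) f
  rw [Real.map_matrix_volume_pi_eq_smul_volume_pi hP, integral_smul_measure] at h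
  rw [← abs_inv, ← ENNReal.toReal_ofReal (abs_nonneg (P.det)⁻¹)]
  exact h.symm

theorem integrable_comp_mulVec {n : ℕ} {P : Matrix (Fin n) (Fin n) ℝ} (hP : P.det ≠ 0)
    {E : Type*} [NormedAddCommGroup E] {f : (Fin n → ℝ) → E} (hf : Integrable f) :
    Integrable fun v => f (P *ᵥ v) := by
  have hemb := measurableEmbedding_toLin' hP
  refine (hemb.integrable_map_iff (μ := volume) (g := f)).1 ?_
  rw [Real.map_matrix_volume_pi_eq_smul_volume_pi hP]
  exact hf.smul_measure ENNReal.ofReal_ne_top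

theorem exists_simultaneous_diagonalization {n : ℕ} {s : Fin n → ℝ} (hs : ∀ i, 0 < s i)
    {K : Matrix (Fin n) (Fin n) ℝ} (hK : K.IsHermitian) :
    ∃ (P : Matrix (Fin n) (Fin n) ℝ) (l : Fin n → ℝ),
      Pᵀ * diagonal s * P = 1 ∧ Pᵀ * K * P = diagonal l := by
  set S : Matrix (Fin n) (Fin n) ℝ := diagonal fun i => (√(s i))⁻¹ with hS
  have hM : (S * K * S).IsHermitian := by
    have : Sᴴ = S := by simp [hS]
    rw [IsHermitian, conjTranspose_mul, conjTranspose_mul, hK.eq, this, mul_assoc]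
  have hU := hM.conjStarAlgAut_star_eigenvectorUnitary
  rw [Unitary.conjStarAlgAut_star_apply] at hU
  refine ⟨S * hM.eigenvectorUnitary, hM.eigenvalues, ?_, ?_⟩
  · have hD : S * diagonal s * S = 1 := by
      rw [hS, diagonal_mul_diagonal, diagonal_mul_diagonal, ← diagonal_one]
      congr 1
      ext i
      have := Real.sqrt_pos.2 (hs i)
      have h2 := Real.mul_self_sqrt (hs i).le
      field_simp
      nlinarith
    have hUU : (hM.eigenvectorUnitary : Matrix (Fin n) (Fin n) ℝ)ᵀ *
      hM.eigenvectorUnitary = 1 := Unitary.coe_star_mul_self hM.eigenvectorUnitary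
    rw [transpose_mul, show Sᵀ = S by simp [hS]]
    calc _ = (hM.eigenvectorUnitary : Matrix (Fin n) (Fin n) ℝ)ᵀ * (S * diagonal s * S) *
          hM.eigenvectorUnitary := by simp only [mul_assoc]
      _ = 1 := by rw [hD, mul_one, hUU]
  · rw [transpose_mul, show Sᵀ = S by simp [hS]]
    calc _ = (hM.eigenvectorUnitary : Matrix (Fin n) (Fin n) ℝ)ᵀ * (S * K * S) *
          hM.eigenvectorUnitary := by simp only [mul_assoc]
      _ = _ := hU

/-- The quadratic form of `Amat` splits into its real diagonal part and its imaginary part. -/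
theorem sum_Amat_eq (n : ℕ) (s ξ : Fin n → ℝ) :
    ∑ j, ∑ k, Amat n s j k * (ξ j : ℂ) * (ξ k : ℂ) =
      ((ξ ⬝ᵥ diagonal s *ᵥ ξ : ℝ) : ℂ) + Complex.I * ((ξ ⬝ᵥ Kmin n *ᵥ ξ : ℝ) : ℂ) := by
  simp only [dotProduct, mulVec, Complex.ofReal_sum, Complex.ofReal_mul, Finset.mul_sum,
    ← Finset.sum_add_distrib]
  refine Finset.sum_congr rfl fun j _ => Finset.sum_congr rfl fun k _ => ?_
  by_cases hjk : j = k <;> simp [Amat, hjk] <;> ring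

theorem dotProduct_mulVec_congruence {n : ℕ} (P B : Matrix (Fin n) (Fin n) ℝ) (η : Fin n → ℝ) :
    (P *ᵥ η) ⬝ᵥ B *ᵥ (P *ᵥ η) = η ⬝ᵥ (Pᵀ * B * P) *ᵥ η := by
  rw [mulVec_mulVec, dotProduct_mulVec, vecMul_mulVec, ← dotProduct_mulVec, mul_assoc]

/-- A real matrix `P` simultaneously diagonalizing `diag(s)` (to the identity) and `Kmin`. -/
structure Diagonalizes {n : ℕ} (s : Fin n → ℝ) (P : Matrix (Fin n) (Fin n) ℝ)
    (l : Fin n → ℝ) : Prop where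
  pos : ∀ i, 0 < s i
  diag : Pᵀ * diagonal s * P = 1
  kmin : Pᵀ * Kmin n * P = diagonal l

theorem exists_diagonalizes {n : ℕ} {s : Fin n → ℝ} (hs : ∀ i, 0 < s i) :
    ∃ P l, Diagonalizes s P l := by
  have hK : (Kmin n).IsHermitian := by
    ext i j
    simp [Kmin, min_comm]
  obtain ⟨P, l, h1, h2⟩ := exists_simultaneous_diagonalization hs hK
  exact ⟨P, l, hs, h1, h2⟩

namespace Diagonalizes

variable {n : ℕ} {s : Fin n → ℝ} {P : Matrix (Fin n) (Fin n) ℝ} {l : Fin n → ℝ}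

theorem det_sq_mul (h : Diagonalizes s P l) : P.det ^ 2 * ∏ i, s i = 1 := by
  have := congrArg det h.diag
  rw [det_mul, det_mul, det_transpose, det_diagonal, det_one] at this
  rw [← this]
  ring

theorem det_ne_zero (h : Diagonalizes s P l) : P.det ≠ 0 := fun h0 => by
  simpa [h0] using h.det_sq_mul

theorem abs_det (h : Diagonalizes s P l) : |P.det| = ∏ i, (√(s i))⁻¹ := by
  rw [← Real.sqrt_sq_eq_abs, eq_inv_of_mul_eq_one_left h.det_sq_mul, Real.sqrt_inv,
    Finset.prod_inv_distrib, Real.sqrt_prod _ fun i _ => (h.pos i).le]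

theorem prod_norm (h : Diagonalizes s P l) :
    ∏ j, ‖1 + Complex.I * (l j : ℂ)‖ = ‖(Amat n s).det‖ * P.det ^ 2 := by
  have hA : (P.map Complex.ofReal)ᵀ * Amat n s * P.map Complex.ofReal =
      diagonal fun j => 1 + Complex.I * (l j : ℂ) := by
    have h1 := congrArg (fun M => M.map Complex.ofRealHom) h.diag
    have h2 := congrArg (fun M => M.map Complex.ofRealHom) h.kmin
    simp only [Matrix.map_mul] at h1 h2
    change (P.map Complex.ofReal)ᵀ * (diagonal s).map Complex.ofReal * P.map Complex.ofReal = _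
      at h1
    change (P.map Complex.ofReal)ᵀ * (Kmin n).map Complex.ofReal * P.map Complex.ofReal = _
      at h2
    rw [Amat, mul_add, add_mul, h1, mul_smul_comm, smul_mul_assoc, h2]
    ext i j
    by_cases hij : i = j <;> simp [hij, one_apply]
  have := congrArg (fun M => ‖det M‖) hA
  have hdet : (P.map Complex.ofReal).det = (P.det : ℂ) := (Complex.ofRealHom.map_det P).symm
  simp only [det_mul, det_transpose, hdet, det_diagonal, norm_mul, norm_prod,
    Complex.norm_real] at this
  rw [← this, ← sq_abs P.det, Real.norm_eq_abs]
  ring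

theorem sum_Amat_mulVec (h : Diagonalizes s P l) (η : Fin n → ℝ) :
    ∑ j, ∑ k, Amat n s j k * ((P *ᵥ η) j : ℂ) * ((P *ᵥ η) k : ℂ) =
      ∑ j, (1 + Complex.I * (l j : ℂ)) * (η j : ℂ) ^ 2 := by
  rw [sum_Amat_eq, dotProduct_mulVec_congruence, dotProduct_mulVec_congruence, h.diag, h.kmin]
  simp only [dotProduct, one_mulVec, mulVec_diagonal, Complex.ofReal_sum, Complex.ofReal_mul,
    Finset.mul_sum, ← Finset.sum_add_distrib]
  exact Finset.sum_congr rfl fun j _ => by ring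

theorem gsn_eq (h : Diagonalizes s P l) (x : Fin n → ℝ) :
    gsn n s x = (((2 * Real.pi) ^ n : ℝ)⁻¹ * |P.det|) •
      ∏ j, ((2 * Real.pi / (1 + Complex.I * (l j : ℂ))) ^ (1 / 2 : ℂ) *
        Complex.exp (-(((Pᵀ *ᵥ x) j : ℂ) ^ 2) / (2 * (1 + Complex.I * (l j : ℂ))))) := by
  have hint := integral_comp_mulVec h.det_ne_zero fun ξ : Fin n → ℝ =>
    Complex.exp (-(∑ j : Fin n, ∑ k : Fin n, Amat n s j k * (ξ j : ℂ) * (ξ k : ℂ)) / 2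
        - Complex.I * (∑ j : Fin n, (ξ j : ℂ) * (x j : ℂ)))
  have hP := abs_pos.2 h.det_ne_zero
  rw [gsn, mul_smul]
  congr 1
  rw [eq_inv_smul_iff₀ hP.ne'] at hint
  rw [← hint]
  congr 1
  have hfac : ∀ η : Fin n → ℝ,
      Complex.exp (-(∑ j, ∑ k, Amat n s j k * ((P *ᵥ η) j : ℂ) * ((P *ᵥ η) k : ℂ)) / 2
        - Complex.I * (∑ j : Fin n, ((P *ᵥ η) j : ℂ) * (x j : ℂ))) =
      ∏ j, Complex.exp (-((1 + Complex.I * (l j : ℂ)) * (η j : ℂ) ^ 2) / 2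
        - Complex.I * (η j * (Pᵀ *ᵥ x) j)) := by
    intro η
    have hdot : ∑ j, ((P *ᵥ η) j : ℂ) * (x j : ℂ) = ∑ j, (η j : ℂ) * ((Pᵀ *ᵥ x) j : ℂ) := by
      have : (P *ᵥ η) ⬝ᵥ x = η ⬝ᵥ (Pᵀ *ᵥ x) := by
        rw [mulVec_transpose, dotProduct_comm, dotProduct_mulVec, dotProduct_comm]
      exact_mod_cast this
    rw [h.sum_Amat_mulVec, hdot, ← Complex.exp_sum, Finset.sum_sub_distrib, Finset.mul_sum,
      ← Finset.sum_div, Finset.sum_neg_distrib]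
  simp_rw [hfac]
  rw [integral_fintype_prod_volume_eq_prod (fun j (t : ℝ) =>
    Complex.exp (-((1 + Complex.I * (l j : ℂ)) * (t : ℂ) ^ 2) / 2
        - Complex.I * (t * (Pᵀ *ᵥ x) j)))]
  exact Finset.prod_congr rfl fun j _ => integral_gaussian_character (by simp) _

theorem integrable_gsn (h : Diagonalizes s P l) : Integrable (gsn n s) := by
  rw [funext h.gsn_eq]
  refine Integrable.smul (((2 * Real.pi) ^ n : ℝ)⁻¹ * |P.det|) (μ := volume) ?_
  refine integrable_comp_mulVec (P := Pᵀ) (f := fun y : Fin n → ℝ =>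
    ∏ j, ((2 * Real.pi / (1 + Complex.I * (l j : ℂ))) ^ (1 / 2 : ℂ) *
      Complex.exp (-((y j : ℂ) ^ 2) / (2 * (1 + Complex.I * (l j : ℂ))))))
    (by rw [det_transpose]; exact h.det_ne_zero) ?_
  exact Integrable.fintype_prod (f := fun j (t : ℝ) =>
    ((2 * Real.pi / (1 + Complex.I * (l j : ℂ))) ^ (1 / 2 : ℂ) *
      Complex.exp (-((t : ℂ) ^ 2) / (2 * (1 + Complex.I * (l j : ℂ))))))
    fun j => integrable_gaussian_transform (by simp)

theorem integral_norm_gsn (h : Diagonalizes s P l) :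
    ∫ x, ‖gsn n s x‖ = √‖(Amat n s).det‖ * ∏ i, (√(s i))⁻¹ := by
  have hP := abs_pos.2 h.det_ne_zero
  simp_rw [h.gsn_eq, norm_smul, norm_prod]
  rw [integral_const_mul, integral_comp_mulVec (P := Pᵀ)
    (by rw [det_transpose]; exact h.det_ne_zero) (fun y : Fin n → ℝ =>
    ∏ j, ‖((2 * Real.pi / (1 + Complex.I * (l j : ℂ))) ^ (1 / 2 : ℂ) *
      Complex.exp (-((y j : ℂ) ^ 2) / (2 * (1 + Complex.I * (l j : ℂ)))))‖),
    integral_fintype_prod_volume_eq_prod (fun j (t : ℝ) =>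
    ‖((2 * Real.pi / (1 + Complex.I * (l j : ℂ))) ^ (1 / 2 : ℂ) *
      Complex.exp (-((t : ℂ) ^ 2) / (2 * (1 + Complex.I * (l j : ℂ)))))‖),
    Finset.prod_congr rfl fun j _ => integral_norm_gaussian_transform
      (c := 1 + Complex.I * (l j : ℂ)) (by simp),
    Finset.prod_mul_distrib, ← Real.sqrt_prod _ fun i _ => norm_nonneg _, h.prod_norm,
    Real.sqrt_mul (norm_nonneg _), Real.sqrt_sq_eq_abs, det_transpose, ← h.abs_det]
  rw [Real.norm_of_nonneg (by positivity)]
  simp only [Finset.prod_const, Finset.card_univ, Fintype.card_fin, smul_eq_mul]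
  have := Real.pi_pos
  field_simp

theorem integral_character_mul_gsn (h : Diagonalizes s P l) (ξ : Fin n → ℝ) :
    ∫ x : Fin n → ℝ, Complex.exp (Complex.I * (∑ k, (ξ k : ℂ) * (x k : ℂ))) * gsn n s x =
      Complex.exp (-(∑ j, ∑ k, Amat n s j k * (ξ j : ℂ) * (ξ k : ℂ)) / 2) := by
  have hP := abs_pos.2 h.det_ne_zero
  obtain ⟨ζ, rfl⟩ : ∃ ζ, P *ᵥ ζ = ξ :=
    ⟨P⁻¹ *ᵥ ξ, by rw [mulVec_mulVec, mul_nonsing_inv _ (isUnit_iff_ne_zero.2 h.det_ne_zero),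
      one_mulVec]⟩
  have hfac : ∀ x : Fin n → ℝ,
      Complex.exp (Complex.I * (∑ k, ((P *ᵥ ζ) k : ℂ) * (x k : ℂ))) * gsn n s x =
      (((2 * Real.pi) ^ n : ℝ)⁻¹ * |P.det|) •
      ∏ j, (Complex.exp (Complex.I * (ζ j * (Pᵀ *ᵥ x) j)) *
        ((2 * Real.pi / (1 + Complex.I * (l j : ℂ))) ^ (1 / 2 : ℂ) *
        Complex.exp (-(((Pᵀ *ᵥ x) j : ℂ) ^ 2) / (2 * (1 + Complex.I * (l j : ℂ)))))) := by
    intro x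
    have hdot : ∑ j, ((P *ᵥ ζ) j : ℂ) * (x j : ℂ) = ∑ j, (ζ j : ℂ) * ((Pᵀ *ᵥ x) j : ℂ) := by
      have : (P *ᵥ ζ) ⬝ᵥ x = ζ ⬝ᵥ (Pᵀ *ᵥ x) := by
        rw [mulVec_transpose, dotProduct_comm, dotProduct_mulVec, dotProduct_comm]
      exact_mod_cast this
    rw [h.gsn_eq, hdot, mul_smul_comm, Finset.mul_sum, Complex.exp_sum,
      ← Finset.prod_mul_distrib]
  simp_rw [hfac]
  rw [integral_smul, integral_comp_mulVec (P := Pᵀ)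
    (by rw [det_transpose]; exact h.det_ne_zero) (fun y : Fin n → ℝ =>
    ∏ j, (Complex.exp (Complex.I * (ζ j * y j)) *
        ((2 * Real.pi / (1 + Complex.I * (l j : ℂ))) ^ (1 / 2 : ℂ) *
        Complex.exp (-((y j : ℂ) ^ 2) / (2 * (1 + Complex.I * (l j : ℂ))))))),
    integral_fintype_prod_volume_eq_prod (fun j (t : ℝ) =>
    (Complex.exp (Complex.I * (ζ j * t)) *
        ((2 * Real.pi / (1 + Complex.I * (l j : ℂ))) ^ (1 / 2 : ℂ) *
        Complex.exp (-((t : ℂ) ^ 2) / (2 * (1 + Complex.I * (l j : ℂ))))))),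
    Finset.prod_congr rfl fun j _ => integral_character_mul_gaussian_transform
      (c := 1 + Complex.I * (l j : ℂ)) (by simp) (ζ j),
    Finset.prod_mul_distrib, ← Complex.exp_sum, det_transpose, h.sum_Amat_mulVec, smul_smul,
    mul_assoc, mul_inv_cancel₀ hP.ne', mul_one, ← Finset.sum_div, Finset.sum_neg_distrib,
    Finset.prod_const, Finset.card_univ, Fintype.card_fin, Complex.real_smul, ← mul_assoc]
  have : (Real.pi : ℂ) ≠ 0 := by exact_mod_cast Real.pi_ne_zero
  push_cast
  rw [inv_mul_cancel₀ (pow_ne_zero _ (mul_ne_zero two_ne_zero this)), one_mul]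

end Diagonalizes

theorem norm_det_Amat_le {n : ℕ} {s : Fin n → ℝ} (hs : ∀ i, 0 < s i) :
    ‖(Amat n s).det‖ ≤ (n.factorial * (n + 1) ^ n : ℝ) * ∏ i, (1 + s i) ^ n := by
  have h1 : 1 ≤ ∏ i, (1 + s i) := Finset.one_le_prod fun i _ => by linarith [hs i]
  have hentry : ∀ i j, ‖Amat n s i j‖ ≤ (n + 1) * ∏ i, (1 + s i) := by
    intro i j
    have hd : ‖((diagonal s i j : ℝ) : ℂ)‖ ≤ ∏ i, (1 + s i) := by
      rw [Complex.norm_real, Real.norm_eq_abs]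
      by_cases hij : i = j
      · subst hij
        rw [diagonal_apply_eq, abs_of_pos (hs i),
          ← Finset.mul_prod_erase _ _ (Finset.mem_univ i)]
        have : 1 ≤ ∏ k ∈ Finset.univ.erase i, (1 + s k) :=
          Finset.one_le_prod fun i _ => by linarith [hs i]
        nlinarith [hs i]
      · rw [diagonal_apply_ne _ hij, abs_zero]
        linarith
    have hk : ‖Complex.I * (Kmin n i j : ℂ)‖ ≤ n := by
      rw [norm_mul, Complex.norm_I, one_mul, Complex.norm_real, Kmin, of_apply, Real.norm_natCast]
      exact_mod_cast (min_le_left _ _).trans i.isLt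
    calc ‖Amat n s i j‖ = ‖((diagonal s i j : ℝ) : ℂ) + Complex.I * (Kmin n i j : ℂ)‖ := rfl
      _ ≤ ∏ i, (1 + s i) + n := (norm_add_le _ _).trans (add_le_add hd hk)
      _ ≤ _ := by nlinarith [Nat.cast_nonneg (α := ℝ) n]
  have := det_le (abv := NormedField.toAbsoluteValue ℂ) hentry
  rw [Fintype.card_fin, nsmul_eq_mul, mul_pow, ← mul_assoc, ← Finset.prod_pow] at this
  exact this

theorem integral_norm_gsn_le {n : ℕ} {s : Fin n → ℝ} (hs : ∀ i, 0 < s i) :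
    ∫ x, ‖gsn n s x‖ ≤
      (n.factorial * (n + 1) ^ n : ℝ) * ∏ i, ((1 + s i) ^ n * (√(s i))⁻¹) := by
  obtain ⟨P, l, h⟩ := exists_diagonalizes hs
  have h1 : 1 ≤ (n.factorial * (n + 1) ^ n : ℝ) * ∏ i, (1 + s i) ^ n := by
    refine one_le_mul_of_one_le_of_one_le (one_le_mul_of_one_le_of_one_le ?_ ?_) ?_
    · exact_mod_cast n.factorial_pos
    · exact one_le_pow₀ (by linarith [Nat.cast_nonneg (α := ℝ) n])
    · exact Finset.one_le_prod fun i _ => one_le_pow₀ (by linarith [hs i])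
  rw [h.integral_norm_gsn, Finset.prod_mul_distrib, ← mul_assoc]
  gcongr
  refine (Real.sqrt_le_sqrt (norm_det_Amat_le hs)).trans ?_
  exact Real.sqrt_le_iff.2 ⟨by linarith, by nlinarith⟩

theorem integrableOn_one_add_pow_mul_inv_sqrt_mul_exp (n : ℕ) {b : ℝ} (hb : 0 < b) :
    IntegrableOn (fun t : ℝ => (1 + t) ^ n * (√t)⁻¹ * Real.exp (-t / b)) (Ioi 0) := by
  have hterm : ∀ k ∈ Finset.range (n + 1), IntegrableOn (fun t : ℝ =>
      (n.choose k : ℝ) * (t ^ ((k : ℝ) - 1 / 2) * Real.exp (-b⁻¹ * t ^ (1 : ℝ)))) (Ioi 0) := by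
    intro k _
    refine Integrable.const_mul (integrableOn_rpow_mul_exp_neg_mul_rpow ?_ one_pos
      (inv_pos.2 hb)) _
    linarith [Nat.cast_nonneg (α := ℝ) k]
  refine (integrable_finsetSum _ hterm).congr ?_
  filter_upwards [ae_restrict_mem measurableSet_Ioi] with t ht
  have ht : 0 < t := ht
  rw [add_comm 1 t, add_pow, Finset.sum_mul, Finset.sum_mul]
  refine Finset.sum_congr rfl fun k _ => ?_
  rw [Real.rpow_sub ht, Real.rpow_natCast, Real.rpow_one, ← Real.sqrt_eq_rpow]
  rw [show -b⁻¹ * t = -t / b by ring]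
  ring

theorem stronglyMeasurable_gsn (n : ℕ) :
    StronglyMeasurable fun p : (Fin n → ℝ) × (Fin n → ℝ) => gsn n p.2 p.1 := by
  unfold gsn
  refine StronglyMeasurable.const_smul (𝕜 := ℝ) (StronglyMeasurable.integral_prod_right
    (ν := volume) (f := fun (p : (Fin n → ℝ) × (Fin n → ℝ)) (ξ : Fin n → ℝ) => Complex.exp
      (-(∑ j : Fin n, ∑ k : Fin n, Amat n p.2 j k * (ξ j : ℂ) * (ξ k : ℂ)) / 2
        - Complex.I * (∑ j : Fin n, (ξ j : ℂ) * (p.1 j : ℂ)))) ?_) _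
  refine Continuous.stronglyMeasurable ?_
  have hA : ∀ j k, Continuous fun q : ((Fin n → ℝ) × (Fin n → ℝ)) × (Fin n → ℝ) =>
      Amat n q.1.2 j k := by
    intro j k
    simp only [Amat, Matrix.add_apply, Matrix.smul_apply, map_apply, diagonal_apply]
    split_ifs <;> fun_prop
  simp only [Function.uncurry_def]
  fun_prop

theorem restrict_pi_Ioi (n : ℕ) :
    (volume : Measure (Fin n → ℝ)).restrict (Set.univ.pi fun _ => Ioi (0 : ℝ)) =
      Measure.pi fun _ => volume.restrict (Ioi (0 : ℝ)) := by
  rw [volume_pi, Measure.restrict_pi_pi]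

theorem ae_pos_of_restrict_pi_Ioi (n : ℕ) :
    ∀ᵐ s ∂(volume : Measure (Fin n → ℝ)).restrict (Set.univ.pi fun _ => Ioi (0 : ℝ)),
      ∀ i, 0 < s i := by
  filter_upwards [ae_restrict_mem (MeasurableSet.univ_pi fun _ => measurableSet_Ioi)]
    with s hs i using hs i trivial

theorem integrable_character_mul_weight_mul_gsn {β : ℕ → ℝ} (hβ : ∀ i, 0 < β i) (n : ℕ)
    (ξ : Fin n → ℝ) :
    Integrable (Function.uncurry fun x s : Fin n → ℝ =>
      Complex.exp (Complex.I * (∑ k : Fin n, (ξ k : ℂ) * (x k : ℂ))) *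
        (((∏ i : Fin n, (β (i : ℕ))⁻¹ * Real.exp (-(s i) / β (i : ℕ)) : ℝ) : ℂ) * gsn n s x))
      (volume.prod (volume.restrict (Set.univ.pi fun _ => Ioi (0 : ℝ)))) := by
  have hnorm : ∀ x s : Fin n → ℝ, ‖Complex.exp (Complex.I * (∑ k : Fin n, (ξ k : ℂ) * (x k : ℂ))) *
        (((∏ i : Fin n, (β (i : ℕ))⁻¹ * Real.exp (-(s i) / β (i : ℕ)) : ℝ) : ℂ) * gsn n s x)‖ =
      (∏ i : Fin n, (β (i : ℕ))⁻¹ * Real.exp (-(s i) / β (i : ℕ))) * ‖gsn n s x‖ := by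
    intro x s
    have h1 : ‖Complex.exp (Complex.I * (∑ k : Fin n, (ξ k : ℂ) * (x k : ℂ)))‖ = 1 := by
      have := Complex.norm_exp_I_mul_ofReal (∑ k, ξ k * x k)
      push_cast at this
      exact this
    rw [norm_mul, h1, one_mul, norm_mul, Complex.norm_real, Real.norm_of_nonneg]
    exact Finset.prod_nonneg fun i _ => by have := hβ i; positivity
  have hmeas : StronglyMeasurable (Function.uncurry fun x s : Fin n → ℝ =>
      Complex.exp (Complex.I * (∑ k : Fin n, (ξ k : ℂ) * (x k : ℂ))) *
        (((∏ i : Fin n, (β (i : ℕ))⁻¹ * Real.exp (-(s i) / β (i : ℕ)) : ℝ) : ℂ) *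
          gsn n s x)) := by
    refine StronglyMeasurable.mul (Continuous.stronglyMeasurable (by fun_prop))
      (StronglyMeasurable.mul (Continuous.stronglyMeasurable (by fun_prop))
        (stronglyMeasurable_gsn n))
  rw [integrable_prod_iff' hmeas.aestronglyMeasurable]
  simp only [Function.uncurry_apply_pair, hnorm]
  constructor
  · filter_upwards [ae_pos_of_restrict_pi_Ioi n] with s hs
    obtain ⟨P, l, h⟩ := exists_diagonalizes hs
    refine (integrable_norm_iff
      (hmeas.comp_measurable measurable_prodMk_right).aestronglyMeasurable).1 ?_
    simp only [Function.comp_apply, Function.uncurry_apply_pair, hnorm]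
    exact h.integrable_gsn.norm.const_mul _
  · simp_rw [integral_const_mul]
    have hdom : Integrable (fun s : Fin n → ℝ => (n.factorial * (n + 1) ^ n : ℝ) *
        ∏ i : Fin n, ((β i)⁻¹ * ((1 + s i) ^ n * (√(s i))⁻¹ * Real.exp (-(s i) / β i))))
        (volume.restrict (Set.univ.pi fun _ => Ioi (0 : ℝ))) := by
      rw [restrict_pi_Ioi]
      refine Integrable.const_mul (Integrable.fintype_prod (f := fun (i : Fin n) (t : ℝ) =>
        (β i)⁻¹ * ((1 + t) ^ n * (√t)⁻¹ * Real.exp (-t / β i))) fun i => ?_) _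
      exact (integrableOn_one_add_pow_mul_inv_sqrt_mul_exp n (hβ i)).const_mul _
    refine hdom.mono' ?_ ?_
    · refine (StronglyMeasurable.mul (Continuous.stronglyMeasurable (by fun_prop))
        ?_).aestronglyMeasurable
      exact StronglyMeasurable.integral_prod_left' (stronglyMeasurable_gsn n).norm
    · filter_upwards [ae_pos_of_restrict_pi_Ioi n] with s hs
      have hw : 0 ≤ ∏ i : Fin n, (β (i : ℕ))⁻¹ * Real.exp (-(s i) / β (i : ℕ)) :=
        Finset.prod_nonneg fun i _ => by have := hβ i; positivity
      rw [Real.norm_of_nonneg (mul_nonneg hw (integral_nonneg fun x => norm_nonneg _))]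
      refine (mul_le_mul_of_nonneg_left (integral_norm_gsn_le hs) hw).trans_eq ?_
      rw [mul_left_comm, ← Finset.prod_mul_distrib]
      congr 1
      exact Finset.prod_congr rfl fun i _ => by ring

theorem integral_exp_weight {b : ℝ} (hb : 0 < b) (u : ℝ) :
    ∫ t in Ioi (0 : ℝ), (((b⁻¹ * Real.exp (-t / b) * Real.exp (-(t * u ^ 2) / 2) : ℝ)) : ℂ) =
      ((1 : ℂ) + (b : ℂ) * (u : ℂ) ^ 2 / 2)⁻¹ := by
  have hneg : -(b⁻¹ + u ^ 2 / 2) < 0 := by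
    have := inv_pos.2 hb
    nlinarith [sq_nonneg u]
  have h := integral_exp_mul_Ioi hneg 0
  have hcongr : ∀ t : ℝ, b⁻¹ * Real.exp (-t / b) * Real.exp (-(t * u ^ 2) / 2) =
      b⁻¹ * Real.exp (-(b⁻¹ + u ^ 2 / 2) * t) := by
    intro t
    rw [mul_assoc, ← Real.exp_add]
    congr 2
    ring
  simp_rw [hcongr]
  rw [integral_complex_ofReal, integral_const_mul, h, mul_zero, Real.exp_zero, neg_div_neg_eq,
    show b⁻¹ * (1 / (b⁻¹ + u ^ 2 / 2)) = (1 + b * u ^ 2 / 2)⁻¹ by field_simp]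
  push_cast
  rfl

/-- The Fourier transform of the Feynman–Thomas measure `μ^{(n)}` is
`∫ e^{i⟨ξ,x⟩} μ^{(n)}(dx) = Π_i (1 + β_i ξ_i²/2)⁻¹ · exp(−(i/2)Σ_{j,k} min(j,k) ξ_j ξ_k)`. -/
theorem feynman_thomas_fourier_transform (β : ℕ → ℝ) (hβ : ∀ i, 0 < β i)
    (n : ℕ) (hn : 1 ≤ n) (ξ : Fin n → ℝ) :
    ∫ x : Fin n → ℝ,
        Complex.exp (Complex.I * (∑ k : Fin n, (ξ k : ℂ) * (x k : ℂ))) * rhoFT β n x =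
      (∏ i : Fin n, ((1 : ℂ) + (β (i : ℕ) : ℂ) * (ξ i : ℂ) ^ 2 / 2)⁻¹) *
        Complex.exp (-(Complex.I / 2) *
          ∑ j : Fin n, ∑ k : Fin n,
            ((min ((j : ℕ) + 1) ((k : ℕ) + 1) : ℕ) : ℂ) * (ξ j : ℂ) * (ξ k : ℂ)) := by
  have hswap := integral_integral_swap (integrable_character_mul_weight_mul_gsn hβ n ξ)
  simp_rw [integral_const_mul] at hswap
  simp only [rhoFT]
  rw [hswap]
  have hinner : ∀ᵐ s ∂(volume : Measure (Fin n → ℝ)).restrict (Set.univ.pi fun _ => Ioi (0 : ℝ)),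
      ∫ x : Fin n → ℝ, Complex.exp (Complex.I * (∑ k : Fin n, (ξ k : ℂ) * (x k : ℂ))) *
        (((∏ i : Fin n, (β (i : ℕ))⁻¹ * Real.exp (-(s i) / β (i : ℕ)) : ℝ) : ℂ) * gsn n s x) =
      (∏ i : Fin n, (((β (i : ℕ))⁻¹ * Real.exp (-(s i) / β (i : ℕ)) *
        Real.exp (-(s i * ξ i ^ 2) / 2) : ℝ) : ℂ)) *
        Complex.exp (-(Complex.I / 2) * ∑ j : Fin n, ∑ k : Fin n,
            ((min ((j : ℕ) + 1) ((k : ℕ) + 1) : ℕ) : ℂ) * (ξ j : ℂ) * (ξ k : ℂ)) := by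
    filter_upwards [ae_pos_of_restrict_pi_Ioi n] with s hs
    obtain ⟨P, l, h⟩ := exists_diagonalizes hs
    simp_rw [mul_left_comm _ ((∏ i : Fin n, _ : ℝ) : ℂ)]
    rw [integral_const_mul, h.integral_character_mul_gsn, sum_Amat_eq]
    have hdiag : ξ ⬝ᵥ diagonal s *ᵥ ξ = ∑ i, s i * ξ i ^ 2 := by
      simp only [dotProduct, mulVec_diagonal]
      exact Finset.sum_congr rfl fun i _ => by ring
    have hker : ((ξ ⬝ᵥ Kmin n *ᵥ ξ : ℝ) : ℂ) = ∑ j : Fin n, ∑ k : Fin n,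
        ((min ((j : ℕ) + 1) ((k : ℕ) + 1) : ℕ) : ℂ) * (ξ j : ℂ) * (ξ k : ℂ) := by
      simp only [dotProduct, mulVec, Finset.mul_sum, Complex.ofReal_sum, Complex.ofReal_mul, Kmin,
        of_apply, Complex.ofReal_natCast]
      exact Finset.sum_congr rfl fun j _ => Finset.sum_congr rfl fun k _ => by ring
    rw [hker, hdiag, ← Complex.ofReal_prod, Finset.prod_mul_distrib (g := fun i =>
      Real.exp (-(s i * ξ i ^ 2) / 2)), ← Real.exp_sum, Complex.ofReal_mul _ (Real.exp _),
      Complex.ofReal_exp, mul_assoc, ← Complex.exp_add]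
    congr 2
    rw [← Finset.sum_div, Finset.sum_neg_distrib]
    push_cast
    ring
  rw [integral_congr_ae hinner, integral_mul_const, restrict_pi_Ioi,
    integral_fintype_prod_eq_prod (fun (i : Fin n) (t : ℝ) => (((β (i : ℕ))⁻¹ *
      Real.exp (-t / β (i : ℕ)) * Real.exp (-(t * ξ i ^ 2) / 2) : ℝ) : ℂ))]
  congr 1
  exact Finset.prod_congr rfl fun i _ => integral_exp_weight (hβ i) (ξ i)
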